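/- arXiv:1110.0876 — 3 statements merged into one kernel-verified Lean document; each statement's English description precedes it below -/
import Mathlib

section
/- Let V and E be types with maps s, t : E → V (the source and target of directed edges), and let r be the step relation on V defined by r u v ↔ ∃ e : E, s e = u ∧ t e = v. Then the following are equivalent: (i) the graph is recurrent, i.e., for every edge e there is a directed path from t e back to s e (Relation.ReflTransGen r (t e) (s e)); (ii) there is no subset S ⊆ V such that every edge with source in S also has target in S, while some edge has source outside S and target in S. -/
/-- A directed graph (vertex type `V`, edge type `E`, source and target maps `s t : E → V`)
is recurrent (every edge lies on a directed cycle, i.e. its source can be reached from its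
target by a directed path) if and only if there is no subset `S ⊆ V` that is closed under
following edges forward (every edge with source in `S` has target in `S`) yet some edge
enters `S` from outside. -/
theorem stmt_1 {V E : Type*} (s t : E → V) :
    (∀ e : E, Relation.ReflTransGen (fun u v => ∃ e' : E, s e' = u ∧ t e' = v) (t e) (s e)) ↔
      ¬ ∃ S : Set V, (∀ e : E, s e ∈ S → t e ∈ S) ∧ (∃ e : E, s e ∉ S ∧ t e ∈ S) := by
  constructor
  · rintro h ⟨S, hS, e, hs, ht⟩
    have reach_mem : ∀ v, Relation.ReflTransGen (fun u v => ∃ e' : E, s e' = u ∧ t e' = v)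
        (t e) v → v ∈ S := by
      intro v hv
      induction hv with
      | refl => exact ht
      | tail _ hstep ih =>
        obtain ⟨e', rfl, rfl⟩ := hstep
        exact hS e' ih
    exact hs (reach_mem _ (h e))
  · intro h e
    by_contra he
    exact h ⟨{v | Relation.ReflTransGen (fun u v => ∃ e' : E, s e' = u ∧ t e' = v) (t e) v},
      fun e' he' => he'.tail ⟨e', rfl, rfl⟩, e, he, .refl⟩
end

section
/- Let h : (Fin n → ℝ) →ₗ[ℝ] (Fin m → ℝ) be a linear map, let x : Fin m → ℝ, and suppose the set E = {k : Fin n → ℝ | (∀ i, 0 ≤ k i) ∧ h k = x} is nonempty. Then E is compact if and only if {k : Fin n → ℝ | (∀ i, 0 ≤ k i) ∧ h k = 0} = {0}. -/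
/-- A continuous linear map on a finite-dimensional space with no nontrivial zeros in a closed cone
is bounded below on that cone. -/
theorem ContinuousLinearMap.exists_pos_mul_norm_le_of_isClosed_cone
    {E F : Type*} [NormedAddCommGroup E] [NormedSpace ℝ E] [FiniteDimensional ℝ E]
    [NormedAddCommGroup F] [NormedSpace ℝ F] (f : E →L[ℝ] F) {C : Set E} (hC : IsClosed C)
    (hsmul : ∀ c : ℝ, 0 ≤ c → ∀ v ∈ C, c • v ∈ C) (hker : ∀ v ∈ C, f v = 0 → v = 0) :
    ∃ c > 0, ∀ v ∈ C, c * ‖v‖ ≤ ‖f v‖ := by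
  have : ProperSpace E := FiniteDimensional.proper ℝ E
  have hK : IsCompact (Metric.sphere (0 : E) 1 ∩ C) := (isCompact_sphere 0 1).inter_right hC
  obtain ⟨c, hc, hle⟩ := hK.exists_forall_le' (f := fun v => ‖f v‖) (a := 0)
    f.continuous.norm.continuousOn fun v hv => norm_pos_iff.2 fun h0 => by
      simpa [hker v hv.2 h0] using hv.1
  refine ⟨c, hc, fun v hv => ?_⟩
  rcases eq_or_ne v 0 with rfl | hv0
  · simp
  have hpos : 0 < ‖v‖ := norm_pos_iff.2 hv0
  have hunit := hle (‖v‖⁻¹ • v)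
    ⟨by simp [norm_smul, hpos.ne'], hsmul _ (inv_nonneg.2 hpos.le) v hv⟩
  simp only [map_smul, norm_smul, norm_inv, norm_norm] at hunit
  rwa [inv_mul_eq_div, le_div_iff₀ hpos] at hunit

/-- A bounded set in a normed space contains no ray with nonzero direction. -/
theorem Bornology.IsBounded.eq_zero_of_forall_add_smul_mem
    {E : Type*} [NormedAddCommGroup E] [NormedSpace ℝ E] {s : Set E}
    (hs : Bornology.IsBounded s) {u v : E} (h : ∀ t : ℝ, 0 ≤ t → u + t • v ∈ s) : v = 0 := by
  obtain ⟨R, hR⟩ := hs.exists_norm_le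
  by_contra hv
  have hpos : 0 < ‖v‖ := norm_pos_iff.2 hv
  have hR0 : 0 ≤ R := (norm_nonneg _).trans (hR _ (h 0 le_rfl))
  set t : ℝ := (R + ‖u‖ + 1) / ‖v‖ with ht
  have ht0 : 0 ≤ t := by positivity
  have htv : ‖t • v‖ = R + ‖u‖ + 1 := by
    rw [norm_smul, Real.norm_of_nonneg ht0, ht, div_mul_cancel₀ _ hpos.ne']
  have hsub := norm_sub_le (u + t • v) u
  rw [add_sub_cancel_left, htv] at hsub
  linarith [hR _ (h t ht0)]

/-- The intersection of the nonnegative orthant with an affine plane `h⁻¹(x)`, if nonempty,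
is compact if and only if the only nonnegative vector in the kernel of `h` is `0`. -/
theorem stmt_2 {n m : ℕ} (h : (Fin n → ℝ) →ₗ[ℝ] (Fin m → ℝ)) (x : Fin m → ℝ)
    (hne : ({k : Fin n → ℝ | (∀ i, 0 ≤ k i) ∧ h k = x}).Nonempty) :
    IsCompact {k : Fin n → ℝ | (∀ i, 0 ≤ k i) ∧ h k = x} ↔
      {k : Fin n → ℝ | (∀ i, 0 ≤ k i) ∧ h k = 0} = {0} := by
  constructor
  · intro hcompact
    obtain ⟨u, hu, hux⟩ := hne
    refine Set.eq_singleton_iff_unique_mem.2 ⟨by simp, fun v hv => ?_⟩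
    refine hcompact.isBounded.eq_zero_of_forall_add_smul_mem (u := u) fun t ht => ⟨fun i => ?_, ?_⟩
    · exact add_nonneg (hu i) (mul_nonneg ht (hv.1 i))
    · simp [hux, hv.2]
  · intro hker
    have horthant : IsClosed {k : Fin n → ℝ | ∀ i, 0 ≤ k i} := isClosed_Ici (a := (0 : Fin n → ℝ))
    obtain ⟨c, hc, hle⟩ :=
      (LinearMap.toContinuousLinearMap h).exists_pos_mul_norm_le_of_isClosed_cone horthant
        (fun c hc v hv i => mul_nonneg hc (hv i)) fun v hv hv0 => hker.subset ⟨hv, hv0⟩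
    refine Metric.isCompact_of_isClosed_isBounded
      (horthant.inter (isClosed_eq h.continuous_of_finiteDimensional continuous_const))
      (isBounded_iff_forall_norm_le.2 ⟨‖x‖ / c, fun k hk => ?_⟩)
    rw [le_div_iff₀' hc, ← hk.2]
    exact hle k hk.1
end

section
/- The commutator subgroup of the free group on two generators is not finitely generated: writing F = FreeGroup (Fin 2), the subgroup [F, F] is not finitely generated as a subgroup. -/
/-- The action of the nonzero rational numbers on the rational line by dilations. -/
def ratDilation : ℚˣ →* MulAut (Multiplicative ℚ) where
  toFun u := AddEquiv.toMultiplicative (DistribMulAction.toAddEquiv ℚ u)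
  map_one' := by ext x; simp
  map_mul' u v := by ext x; simp [mul_smul]

theorem toAdd_ratDilation_apply (u : ℚˣ) (x : Multiplicative ℚ) :
    (ratDilation u x).toAdd = u * x.toAdd :=
  rfl

/-- The affine group of the rational line, as a semidirect product of the translations and the
dilations. -/
abbrev RatAffineGroup : Type :=
  Multiplicative ℚ ⋊[ratDilation] ℚˣ

namespace RatAffineGroup

open scoped commutatorElement

/-- The translations by rational numbers `q` such that `N * q` is an integer. -/
def translations (N : ℤ) : Subgroup RatAffineGroup where
  carrier := {g | g.right = 1 ∧ ∃ z : ℤ, (N : ℚ) * g.left.toAdd = z}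
  one_mem' := ⟨rfl, 0, by simp⟩
  mul_mem' := by
    rintro g h ⟨hg, y, hy⟩ ⟨hh, z, hz⟩
    refine ⟨by simp [hg, hh], y + z, ?_⟩
    simp [hg, mul_add, hy, hz]
  inv_mem' := by
    rintro g ⟨hg, y, hy⟩
    refine ⟨by simp [hg], -y, ?_⟩
    simp [hg, hy]

/-- A finitely generated group of translations has bounded denominators. -/
theorem exists_le_translations {H : Subgroup RatAffineGroup} (hH : H.FG)
    (hright : ∀ g ∈ H, g.right = 1) : ∃ N : ℤ, 0 < N ∧ H ≤ translations N := by
  obtain ⟨S, rfl⟩ := hH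
  refine ⟨∏ g ∈ S, (g.left.toAdd.den : ℤ),
    Finset.prod_pos fun g _ => by exact_mod_cast g.left.toAdd.den_pos, ?_⟩
  rw [Subgroup.closure_le]
  intro g hg
  refine ⟨hright g (Subgroup.subset_closure hg), ?_⟩
  obtain ⟨c, hc⟩ := Finset.dvd_prod_of_mem (fun g : RatAffineGroup => (g.left.toAdd.den : ℤ)) hg
  refine ⟨c * g.left.toAdd.num, ?_⟩
  rw [hc]
  push_cast
  rw [mul_right_comm, Rat.den_mul_eq_num, mul_comm]

/-- The dilation by `1 / 2`. -/
def halving : RatAffineGroup :=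
  SemidirectProduct.inr (Units.mk0 (2⁻¹ : ℚ) (by norm_num))

/-- The translation by `1`. -/
def unitTranslation : RatAffineGroup :=
  SemidirectProduct.inl (Multiplicative.ofAdd 1)

theorem left_commutatorElement_halving_pow (n : ℕ) :
    (⁅halving ^ n, unitTranslation⁆ : RatAffineGroup).left.toAdd = (2⁻¹ : ℚ) ^ n - 1 := by
  rw [commutatorElement_def, halving, unitTranslation, ← map_pow, ← map_inv, ← map_inv,
    ← SemidirectProduct.inl_aut, ← map_mul]
  simp [toAdd_ratDilation_apply, sub_eq_add_neg, -map_pow]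

theorem commutatorElement_halving_pow_notMem_translations {N : ℤ} (hN : 0 < N) :
    ⁅halving ^ N.toNat, unitTranslation⁆ ∉ translations N := by
  rintro ⟨-, z, hz⟩
  rw [left_commutatorElement_halving_pow] at hz
  have hdvd : (2 : ℤ) ^ N.toNat ∣ N := by
    refine ⟨z + N, ?_⟩
    have h : (N : ℚ) = 2 ^ N.toNat * (z + N) := by
      rw [← hz, inv_pow]
      field_simp
      ring
    exact_mod_cast h
  have hle := Int.le_of_dvd hN hdvd
  have hlt : (N.toNat : ℤ) < 2 ^ N.toNat := by exact_mod_cast Nat.lt_two_pow_self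
  lia

end RatAffineGroup

open RatAffineGroup commutatorElement in
/-- The commutator subgroup of the free group on two generators is not finitely generated. -/
theorem stmt_7 : ¬ Subgroup.FG (commutator (FreeGroup (Fin 2))) := by
  intro hFG
  let f : FreeGroup (Fin 2) →* RatAffineGroup := FreeGroup.lift ![halving, unitTranslation]
  obtain ⟨N, hN, hle⟩ := exists_le_translations (H := (commutator _).map f)
    ((Subgroup.fg_iff_submonoid_fg _).2 (((Subgroup.fg_iff_submonoid_fg _).1 hFG).map f)) (by
    rintro _ ⟨x, hx, rfl⟩
    exact Abelianization.commutator_subset_ker (SemidirectProduct.rightHom.comp f) hx)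
  apply commutatorElement_halving_pow_notMem_translations hN
  apply hle
  refine ⟨⁅FreeGroup.of 0 ^ N.toNat, FreeGroup.of 1⁆,
    Subgroup.commutator_mem_commutator (Subgroup.mem_top _) (Subgroup.mem_top _), ?_⟩
  simp [f, map_commutatorElement]
end
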